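/- Suppose P₁, P₂ are formal power series in q^{1/2} (with coefficients in a real vector space) such that P₂ is a modular form of weight 2k over Γ^0(2) written as P₂ = ∑_{r=0}^{[m/2]} h_r (8δ₂)^{m-2r} ε₂^r with real coefficients h_r, and P₁(-1/τ) = 2^{m'} τ^{2m} P₂(τ). Then P₁ = 2^{m'} ∑_{r=0}^{[m/2]} h_r (8δ₁)^{m-2r} ε₁^r, and consequently the constant term (q⁰-coefficient) of P₁ equals 2^{m'} ∑_{r=0}^{[m/2]} 8^{m-2r}·(1/16)^r·h_r·(1/4)^{... } evaluated via the constant terms δ₁(τ)|_{q=0} = 1/4, ε₁(τ)|_{q=0} = 1/16; explicitly, constant term of P₁ = 2^{m'} ∑_r 2^{m-2r}·2^{-4r} h_r = 2^{m'+m} ∑_r 2^{-6r} h_r. -/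

import Mathlib

open Complex

/-- `qp τ s = e^{2πiτs}`, so that `qp τ s = q^s` with `q = e^{2πiτ}`. -/
noncomputable def qp (τ s : ℂ) : ℂ := Complex.exp (2 * (Real.pi : ℂ) * Complex.I * τ * s)

/-- θ₁(0,τ) = 2q^{1/8}∏(1-q^j)(1+q^j)². -/
noncomputable def th1 (τ : ℂ) : ℂ :=
  2 * qp τ (1/8) * ∏' j : ℕ, ((1 - qp τ (j + 1)) * (1 + qp τ (j + 1))^2)

/-- θ₂(0,τ) = ∏(1-q^j)(1-q^{j-1/2})². -/
noncomputable def th2 (τ : ℂ) : ℂ :=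
  ∏' j : ℕ, ((1 - qp τ (j + 1)) * (1 - qp τ ((j : ℂ) + 1/2))^2)

/-- θ₃(0,τ) = ∏(1-q^j)(1+q^{j-1/2})². -/
noncomputable def th3 (τ : ℂ) : ℂ :=
  ∏' j : ℕ, ((1 - qp τ (j + 1)) * (1 + qp τ ((j : ℂ) + 1/2))^2)

noncomputable def delta1 (τ : ℂ) : ℂ := (th2 τ ^ 4 + th3 τ ^ 4) / 8
noncomputable def eps1 (τ : ℂ) : ℂ := th2 τ ^ 4 * th3 τ ^ 4 / 16
noncomputable def delta2 (τ : ℂ) : ℂ := -(th1 τ ^ 4 + th3 τ ^ 4) / 8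
noncomputable def eps2 (τ : ℂ) : ℂ := th1 τ ^ 4 * th3 τ ^ 4 / 16
noncomputable def delta3 (τ : ℂ) : ℂ := (th1 τ ^ 4 - th2 τ ^ 4) / 8
noncomputable def eps3 (τ : ℂ) : ℂ := -(th1 τ ^ 4 * th2 τ ^ 4) / 16

open Filter

noncomputable def auxF (x : ℂ) : ℂ := ∏' n : ℕ, (1 - x ^ (n + 1))
noncomputable def auxA (x : ℂ) : ℂ := ∏' n : ℕ, (1 - x ^ (2 * n + 1))

lemma auxF_mult {x : ℂ} (hx : ‖x‖ < 1) : Multipliable fun n : ℕ => 1 - x ^ (n + 1) :=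
  ModularForm.multipliable_one_sub_pow hx

lemma auxF_ne {x : ℂ} (hx : ‖x‖ < 1) : auxF x ≠ 0 := by
  unfold auxF
  simp only [sub_eq_add_neg]
  refine tprod_one_add_ne_zero_of_summable (f := fun n => -x ^ (n + 1)) ?_ ?_
  · intro i h
    have h1 : x ^ (i + 1) = 1 := by linear_combination -h
    have h2 : ‖x‖ ^ (i + 1) = 1 := by rw [← norm_pow, h1, norm_one]
    have h3 : ‖x‖ ^ (i + 1) < 1 := pow_lt_one₀ (norm_nonneg _) hx (by omega)
    linarith
  · simpa using (summable_nat_add_iff 1).mpr (summable_geometric_of_lt_one (norm_nonneg _) hx)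

lemma auxA_mult {x : ℂ} (hx : ‖x‖ < 1) : Multipliable fun n : ℕ => 1 - x ^ (2 * n + 1) := by
  apply multipliable_one_add_of_summable (f := fun n ↦ -x ^ (2 * n + 1))
  have := (summable_geometric_of_lt_one (norm_nonneg _) hx).comp_injective
    (i := fun n : ℕ => 2 * n + 1) (fun a b h => by simpa using h)
  simpa [Function.comp_def] using this

lemma sq_lt {x : ℂ} (hx : ‖x‖ < 1) : ‖x ^ 2‖ < 1 := by
  rw [norm_pow]; exact pow_lt_one₀ (norm_nonneg _) hx (by norm_num)

lemma auxF_eq {x : ℂ} (hx : ‖x‖ < 1) : auxF x = auxA x * auxF (x ^ 2) := by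
  have h2 : Multipliable fun n : ℕ => 1 - x ^ ((2 * n + 1) + 1) := by
    refine (auxF_mult (sq_lt hx)).congr fun n => ?_
    rw [← pow_mul]; congr 2
  have := tprod_even_mul_odd (f := fun n : ℕ => 1 - x ^ (n + 1)) (auxA_mult hx) h2
  unfold auxF auxA
  rw [← this]
  congr 1
  refine tprod_congr fun n => ?_
  rw [← pow_mul]; congr 2

lemma auxA_mul {x : ℂ} (hx : ‖x‖ < 1) : auxA x * auxA (-x) = auxA (x ^ 2) := by
  unfold auxA
  rw [← (auxA_mult hx).tprod_mul (auxA_mult (by simpa using hx))]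
  refine tprod_congr fun n => ?_
  rw [Odd.neg_pow ⟨n, rfl⟩]; ring

lemma auxF_tendsto : Tendsto auxF (nhds 0) (nhds 1) := by
  have h := (ModularForm.differentiableOn_tprod_one_sub_pow.differentiableAt
    (Metric.ball_mem_nhds (0 : ℂ) one_pos)).continuousAt
  have h2 : auxF 0 = 1 := by simp [auxF]
  have h3 : Tendsto auxF (nhds 0) (nhds (auxF 0)) := h
  rwa [h2] at h3

/-- The square root of the nome. -/
noncomputable def auxx (τ : ℂ) : ℂ := Complex.exp (Real.pi * Complex.I * τ)

lemma auxx_lt {τ : ℂ} (h : 0 < τ.im) : ‖auxx τ‖ < 1 := by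
  rw [auxx, Complex.norm_exp]
  simp only [Real.exp_lt_one_iff]
  simp
  positivity

lemma qp_int (τ : ℂ) (j : ℕ) : qp τ (j + 1) = (auxx τ ^ 2) ^ (j + 1) := by
  rw [qp, auxx, ← pow_mul, ← Complex.exp_nat_mul]
  congr 1; push_cast; ring

lemma qp_half (τ : ℂ) (j : ℕ) : qp τ ((j : ℂ) + 1 / 2) = auxx τ ^ (2 * j + 1) := by
  rw [qp, auxx, ← Complex.exp_nat_mul]
  congr 1; push_cast; ring

lemma th2_eq {τ : ℂ} (h : 0 < τ.im) : th2 τ = auxF (auxx τ ^ 2) * auxA (auxx τ) ^ 2 := by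
  have hx := auxx_lt h
  simp only [th2, qp_int, qp_half]
  rw [auxF, auxA, ← (auxA_mult hx).tprod_pow,
    ← (auxF_mult (sq_lt hx)).tprod_mul ((auxA_mult hx).pow 2)]

lemma th3_eq {τ : ℂ} (h : 0 < τ.im) : th3 τ = auxF (auxx τ ^ 2) * auxA (-auxx τ) ^ 2 := by
  have hx := auxx_lt h
  have hx' : ‖-auxx τ‖ < 1 := by simpa using hx
  simp only [th3, qp_int, qp_half]
  rw [auxF, auxA, ← (auxA_mult hx').tprod_pow,
    ← (auxF_mult (sq_lt hx)).tprod_mul ((auxA_mult hx').pow 2)]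
  refine tprod_congr fun n => ?_
  rw [Odd.neg_pow ⟨n, rfl⟩]; ring

lemma th1_eq {τ : ℂ} (h : 0 < τ.im) : th1 τ * auxF (auxx τ ^ 2) =
    2 * qp τ (1 / 8) * auxF ((auxx τ ^ 2) ^ 2) ^ 2 := by
  have hx := sq_lt (auxx_lt h)
  simp only [th1, qp_int]
  generalize auxx τ ^ 2 = y at *
  have hG : Multipliable fun n : ℕ => 1 + y ^ (n + 1) := by
    apply multipliable_one_add_of_summable
    simpa using (summable_nat_add_iff 1).mpr (summable_geometric_of_lt_one (norm_nonneg _) hx)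
  have h1 : auxF (y ^ 2) = auxF y * ∏' n : ℕ, (1 + y ^ (n + 1)) := by
    unfold auxF
    rw [← (auxF_mult hx).tprod_mul hG]
    refine tprod_congr fun n => ?_
    ring
  rw [(auxF_mult hx).tprod_mul (hG.pow 2), hG.tprod_pow, h1]
  change 2 * qp τ (1 / 8) * (auxF y * _) * _ = _
  ring

lemma eta_eq (τ : ℂ) : ModularForm.eta τ = qp τ (1 / 24) * auxF (auxx τ ^ 2) := by
  rw [ModularForm.eta, auxF]
  congr 1
  · simp only [Function.Periodic.qParam, qp]
    congr 1; push_cast; ring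
  · refine tprod_congr fun n => ?_
    rw [ModularForm.eta_q_eq_cexp, ← qp_int, qp]
    congr 2; ring

lemma th2_eta {τ : ℂ} (h : 0 < τ.im) :
    th2 τ * ModularForm.eta τ = ModularForm.eta (τ / 2) ^ 2 := by
  have hx := auxx_lt h
  rw [eta_eq, eta_eq, th2_eq h]
  have h1 : auxx (τ / 2) ^ 2 = auxx τ := by
    rw [auxx, auxx, ← Complex.exp_nat_mul]; congr 1; push_cast; ring
  have h2 : qp (τ / 2) (1 / 24) ^ 2 = qp τ (1 / 24) := by
    rw [qp, qp, ← Complex.exp_nat_mul]; congr 1; push_cast; ring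
  rw [h1, auxF_eq hx, mul_pow, h2]
  ring

lemma th1_eta {τ : ℂ} (h : 0 < τ.im) :
    th1 τ * ModularForm.eta τ = 2 * ModularForm.eta (2 * τ) ^ 2 := by
  rw [eta_eq, eta_eq]
  have h1 : auxx (2 * τ) = auxx τ ^ 2 := by
    rw [auxx, auxx, ← Complex.exp_nat_mul]; congr 1; push_cast; ring
  have h2 : qp τ (1 / 8) * qp τ (1 / 24) = qp (2 * τ) (1 / 24) ^ 2 := by
    rw [qp, qp, qp, ← Complex.exp_nat_mul, ← Complex.exp_add]; congr 1; push_cast; ring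
  rw [h1, mul_pow, ← h2]
  linear_combination qp τ (1 / 24) * th1_eq h

lemma th_prod {τ : ℂ} (h : 0 < τ.im) :
    th1 τ * th2 τ * th3 τ = 2 * ModularForm.eta τ ^ 3 := by
  have hx := auxx_lt h
  rw [eta_eq, th2_eq h, th3_eq h]
  have h2 : qp τ (1 / 24) ^ 3 = qp τ (1 / 8) := by
    rw [qp, qp, ← Complex.exp_nat_mul]; congr 1; push_cast; ring
  have h3 := auxA_mul hx
  have h4 := auxF_eq (sq_lt hx)
  have h5 := th1_eq h
  rw [mul_pow, h2]
  calc _ = (th1 τ * auxF (auxx τ ^ 2)) * auxF (auxx τ ^ 2) *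
        (auxA (auxx τ) * auxA (-auxx τ)) ^ 2 := by ring
    _ = 2 * qp τ (1 / 8) * auxF (auxx τ ^ 2) *
        (auxA (auxx τ ^ 2) * auxF ((auxx τ ^ 2) ^ 2)) ^ 2 := by rw [h5, h3]; ring
    _ = _ := by rw [← h4]; ring

lemma eta_S {τ : ℂ} (h : 0 < τ.im) :
    ModularForm.eta (-1 / τ) ^ 4 = -τ ^ 2 * ModularForm.eta τ ^ 4 := by
  have h1 := ModularForm.eta_comp_eq_csqrt_I_inv (show τ ∈ UpperHalfPlane.upperHalfPlaneSet from h)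
  have hs : ∀ z : ℂ, Complex.sqrt z ^ 2 = z := by
    intro z
    simp [Complex.sqrt]
  have h2 : ModularForm.eta (-1 / τ) =
    (Complex.sqrt I)⁻¹ * (Complex.sqrt τ * ModularForm.eta τ) := by simpa using h1
  rw [h2, mul_pow, mul_pow, inv_pow, show ∀ z : ℂ, z ^ 4 = (z ^ 2) ^ 2 from fun z => by ring,
    hs, show Complex.sqrt τ ^ 4 = (Complex.sqrt τ ^ 2) ^ 2 by ring, hs, I_sq]
  ring

lemma S_im {τ : ℂ} (h : 0 < τ.im) : 0 < (-1 / τ).im := by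
  have h0 : τ ≠ 0 := by rintro rfl; simp at h
  have := UpperHalfPlane.im_inv_neg_coe_pos ⟨τ, h⟩
  rw [neg_div, one_div, ← inv_neg]
  exact this

lemma th1_S {τ : ℂ} (h : 0 < τ.im) : th1 (-1 / τ) ^ 4 = -τ ^ 2 * th2 τ ^ 4 := by
  have h0 : τ ≠ 0 := by rintro rfl; simp at h
  have e1 := th1_eta (S_im h)
  have h' : 0 < (τ / 2).im := by
    rw [Complex.div_ofNat_im]; positivity
  have e2 := eta_S h'
  rw [show -1 / (τ / 2) = 2 * (-1 / τ) by field_simp] at e2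
  have e3 := th2_eta h
  have e4 := eta_S h
  have hn : ModularForm.eta τ ^ 4 ≠ 0 := pow_ne_zero _ (ModularForm.eta_ne_zero h)
  have key : th1 (-1 / τ) ^ 4 * (-τ ^ 2 * ModularForm.eta τ ^ 4) =
      τ ^ 4 * (th2 τ * ModularForm.eta τ) ^ 4 := by
    rw [← e4, ← mul_pow, e1, e3]
    calc _ = 16 * (ModularForm.eta (2 * (-1 / τ)) ^ 4) ^ 2 := by ring
      _ = _ := by rw [e2]; ring
  have : (-τ ^ 2 * ModularForm.eta τ ^ 4) ≠ 0 := mul_ne_zero (neg_ne_zero.mpr (pow_ne_zero _ h0)) hn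
  apply mul_right_cancel₀ this
  rw [key]; ring

lemma th2_S {τ : ℂ} (h : 0 < τ.im) : th2 (-1 / τ) ^ 4 = -τ ^ 2 * th1 τ ^ 4 := by
  have h0 : τ ≠ 0 := by rintro rfl; simp at h
  have := th1_S (S_im h)
  rw [show -1 / (-1 / τ) = τ by field_simp] at this
  rw [this]; field_simp

lemma th3_S {τ : ℂ} (h : 0 < τ.im) : th3 (-1 / τ) ^ 4 = -τ ^ 2 * th3 τ ^ 4 := by
  have h0 : τ ≠ 0 := by rintro rfl; simp at h
  have e1 := th_prod h
  have e2 := th_prod (S_im h)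
  have hn : ModularForm.eta τ ≠ 0 := ModularForm.eta_ne_zero h
  have hp : th1 τ * th2 τ * th3 τ ≠ 0 := by rw [e1]; simp [hn]
  have h12 : th1 τ * th2 τ ≠ 0 := left_ne_zero_of_mul hp
  have key : τ ^ 4 * (th1 τ * th2 τ) ^ 4 * th3 (-1 / τ) ^ 4 =
      -τ ^ 6 * (th1 τ * th2 τ * th3 τ) ^ 4 := by
    rw [e1]
    calc _ = (-τ ^ 2 * th2 τ ^ 4) * (-τ ^ 2 * th1 τ ^ 4) * th3 (-1 / τ) ^ 4 := by ring
      _ = (th1 (-1 / τ) * th2 (-1 / τ) * th3 (-1 / τ)) ^ 4 := by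
        rw [← th1_S h, ← th2_S h]; ring
      _ = 16 * (ModularForm.eta (-1 / τ) ^ 4) ^ 3 := by rw [e2]; ring
      _ = _ := by rw [eta_S h]; ring
  apply mul_left_cancel₀ (mul_ne_zero (pow_ne_zero 4 h0) (pow_ne_zero 4 h12))
  rw [key]; ring

lemma delta2_S {τ : ℂ} (h : 0 < τ.im) : delta2 (-1 / τ) = τ ^ 2 * delta1 τ := by
  rw [delta2, delta1, th1_S h, th3_S h]; ring

lemma eps2_S {τ : ℂ} (h : 0 < τ.im) : eps2 (-1 / τ) = τ ^ 4 * eps1 τ := by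
  rw [eps2, eps1, th1_S h, th3_S h]; ring

lemma auxx_tendsto : Tendsto (fun t : ℝ => auxx (t * Complex.I)) atTop (nhds 0) := by
  rw [tendsto_zero_iff_norm_tendsto_zero]
  have : (fun t : ℝ => ‖auxx (t * Complex.I)‖) = fun t : ℝ => Real.exp (-(Real.pi * t)) := by
    funext t
    rw [auxx, Complex.norm_exp]
    congr 1
    simp
  rw [this]
  exact Real.tendsto_exp_neg_atTop_nhds_zero.comp (tendsto_id.const_mul_atTop Real.pi_pos)

lemma auxA_tendsto : Tendsto auxA (nhds 0) (nhds 1) := by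
  have h2 : Tendsto (fun x : ℂ => x ^ 2) (nhds 0) (nhds 0) := by
    simpa using (continuous_pow (M := ℂ) 2).tendsto 0
  have := auxF_tendsto.div (auxF_tendsto.comp h2) one_ne_zero
  rw [div_one] at this
  refine this.congr' ?_
  filter_upwards [Metric.ball_mem_nhds (0 : ℂ) one_pos] with x hx
  have hx' : ‖x‖ < 1 := by simpa using hx
  have := auxF_ne (sq_lt hx')
  simp only [Pi.div_apply, Function.comp_apply]
  rw [auxF_eq hx']
  field_simp

lemma th23_tendsto : Tendsto (fun t : ℝ => th2 (t * Complex.I)) atTop (nhds 1) ∧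
    Tendsto (fun t : ℝ => th3 (t * Complex.I)) atTop (nhds 1) := by
  have hF := auxF_tendsto.comp (by simpa using auxx_tendsto.pow 2 :
    Tendsto (fun t : ℝ => auxx (t * Complex.I) ^ 2) atTop (nhds 0))
  have hA := (auxA_tendsto.comp auxx_tendsto).pow 2
  have hB := (auxA_tendsto.comp (by simpa using auxx_tendsto.neg :
    Tendsto (fun t : ℝ => -auxx (t * Complex.I)) atTop (nhds 0))).pow 2
  have a := hF.mul hA
  have b := hF.mul hB
  simp only [one_pow, mul_one] at a b
  constructor
  · refine a.congr' ?_
    filter_upwards [eventually_gt_atTop 0] with t ht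
    exact (th2_eq (by simpa using ht)).symm
  · refine b.congr' ?_
    filter_upwards [eventually_gt_atTop 0] with t ht
    exact (th3_eq (by simpa using ht)).symm

/-- The modular-transfer mechanism behind the cancellation formulas (3.15)–(3.17):
if P₂ = ∑ h_r (8δ₂)^{m-2r} ε₂^r and P₁(-1/τ) = 2^{m'} τ^{2m} P₂(τ), then
P₁ = 2^{m'} ∑ h_r (8δ₁)^{m-2r} ε₁^r and the constant term of the q-expansion of P₁
is 2^{m'+m} ∑ 2^{-6r} h_r. -/
theorem modular_transfer (m m' : ℕ) (h : ℕ → ℝ) (P₁ P₂ : ℂ → ℂ)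
    (hP₂ : ∀ τ : ℂ, 0 < τ.im →
      P₂ τ = ∑ r ∈ Finset.range (m / 2 + 1),
        (h r : ℂ) * (8 * delta2 τ) ^ (m - 2 * r) * eps2 τ ^ r)
    (hP₁ : ∀ τ : ℂ, 0 < τ.im → P₁ (-1/τ) = 2 ^ m' * τ ^ (2 * m) * P₂ τ) :
    (∀ τ : ℂ, 0 < τ.im →
      P₁ τ = 2 ^ m' * ∑ r ∈ Finset.range (m / 2 + 1),
        (h r : ℂ) * (8 * delta1 τ) ^ (m - 2 * r) * eps1 τ ^ r) ∧
    Tendsto (fun t : ℝ => P₁ (t * Complex.I)) atTop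
      (nhds ((2 : ℂ) ^ (m' + m) *
        ∑ r ∈ Finset.range (m / 2 + 1), (h r : ℂ) / 2 ^ (6 * r))) := by
  have main : ∀ τ : ℂ, 0 < τ.im →
      P₁ τ = 2 ^ m' * ∑ r ∈ Finset.range (m / 2 + 1),
        (h r : ℂ) * (8 * delta1 τ) ^ (m - 2 * r) * eps1 τ ^ r := by
    intro τ hτ
    have h0 : τ ≠ 0 := by rintro rfl; simp at hτ
    have e := hP₁ _ (S_im hτ)
    rw [hP₂ _ (S_im hτ), show -1 / (-1 / τ) = τ by field_simp] at e
    rw [e, mul_assoc]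
    congr 1
    rw [Finset.mul_sum]
    refine Finset.sum_congr rfl fun r hr => ?_
    have hr' : 2 * r ≤ m := by
      have := Finset.mem_range.mp hr
      omega
    obtain ⟨k, rfl⟩ := Nat.exists_eq_add_of_le hr'
    rw [delta2_S hτ, eps2_S hτ, Nat.add_sub_cancel_left]
    have h1 : (-1 / τ) ^ (2 * (2 * r + k)) * (τ ^ 2) ^ k * (τ ^ 4) ^ r = 1 := by
      rw [pow_mul (-1 / τ) 2, show (-1 / τ) ^ 2 = (τ ^ 2)⁻¹ by field_simp, inv_pow,
        ← pow_mul, ← pow_mul, ← pow_mul]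
      field_simp
      ring
    rw [show 8 * (τ ^ 2 * delta1 τ) = τ ^ 2 * (8 * delta1 τ) by ring, mul_pow, mul_pow]
    linear_combination (h r : ℂ) * (8 * delta1 τ) ^ k * eps1 τ ^ r * h1
  refine ⟨main, ?_⟩
  obtain ⟨t2, t3⟩ := th23_tendsto
  have d1 : Tendsto (fun t : ℝ => 8 * delta1 (t * Complex.I)) atTop (nhds 2) := by
    have := (((t2.pow 4).add (t3.pow 4)).div_const 8).const_mul 8
    norm_num at this
    simpa [delta1] using this
  have e1 : Tendsto (fun t : ℝ => eps1 (t * Complex.I)) atTop (nhds (1 / 16)) := by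
    have := ((t2.pow 4).mul (t3.pow 4)).div_const 16
    norm_num at this
    simpa [eps1] using this
  have lim : Tendsto (fun t : ℝ => (2 : ℂ) ^ m' * ∑ r ∈ Finset.range (m / 2 + 1),
      (h r : ℂ) * (8 * delta1 (t * Complex.I)) ^ (m - 2 * r) * eps1 (t * Complex.I) ^ r) atTop
      (nhds (2 ^ m' * ∑ r ∈ Finset.range (m / 2 + 1),
        (h r : ℂ) * 2 ^ (m - 2 * r) * (1 / 16) ^ r)) :=
    (tendsto_finsetSum _ fun r _ =>
      ((d1.pow (m - 2 * r)).const_mul (h r : ℂ)).mul (e1.pow r)).const_mul _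
  have val : (2 : ℂ) ^ m' * ∑ r ∈ Finset.range (m / 2 + 1),
        (h r : ℂ) * 2 ^ (m - 2 * r) * (1 / 16) ^ r = (2 : ℂ) ^ (m' + m) *
        ∑ r ∈ Finset.range (m / 2 + 1), (h r : ℂ) / 2 ^ (6 * r) := by
    rw [pow_add, mul_assoc]
    congr 1
    rw [Finset.mul_sum]
    refine Finset.sum_congr rfl fun r hr => ?_
    have hr' : 2 * r ≤ m := by
      have := Finset.mem_range.mp hr
      omega
    obtain ⟨k, rfl⟩ := Nat.exists_eq_add_of_le hr'
    rw [Nat.add_sub_cancel_left, div_pow, one_pow, show (16 : ℂ) = 2 ^ 4 by norm_num, ← pow_mul,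
      show 6 * r = 2 * r + 4 * r by ring, pow_add, pow_add]
    field_simp
  rw [← val]
  refine lim.congr' ?_
  filter_upwards [eventually_gt_atTop 0] with t ht
  exact (main _ (by simpa using ht)).symm
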